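/- For every deterministic online algorithm A for OMSS(2,2) that obeys Rule 1, there exists an instance I such that the makespan of A's assignment on I is at least (5/3)·OPT(I). Hence no deterministic online algorithm for OMSS(2,2) obeying Rule 1 is r-competitive for any r < 5/3. -/

import Mathlib

open Finset

/-- An instance of Online Makespan Scheduling under Scenarios with `K` scenarios:
`n` jobs `1,…,n`, nonnegative processing times `p`, and scenarios `S k ⊆ {1,…,n}`. -/
structure OMSSInstance (K : ℕ) where
  n : ℕ
  p : ℕ → ℝ
  hp : ∀ j, 0 ≤ p j
  S : Fin K → Finset ℕ
  hS : ∀ k, S k ⊆ Finset.Icc 1 n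

/-- A deterministic online algorithm for `OMSS(m,K)`: the machine for job `j` is a
function only of `j`, the processing times revealed so far, and the partial scenarios. -/
abbrev OnlineAlg (m K : ℕ) := ℕ → (ℕ → ℝ) → (Fin K → Finset ℕ) → Fin m

/-- The assignment produced by online algorithm `A` on instance `I`:
for job `j` the algorithm only sees `p_1,…,p_j` and `S_k ∩ [j]`. -/
noncomputable def algAssign {m K : ℕ} (A : OnlineAlg m K) (I : OMSSInstance K) : ℕ → Fin m :=
  fun j => A j (fun j' => if j' ≤ j then I.p j' else 0) (fun k => I.S k ∩ Finset.Icc 1 j)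

/-- Load of machine `i` in scenario `k` under assignment `τ`. -/
noncomputable def load {m K : ℕ} (I : OMSSInstance K) (τ : ℕ → Fin m) (i : Fin m)
    (k : Fin K) : ℝ :=
  ∑ j ∈ (I.S k).filter (fun j => τ j = i), I.p j

/-- Makespan of an assignment: the largest load of a machine in a scenario. -/
noncomputable def mkspan {m K : ℕ} (I : OMSSInstance K) (τ : ℕ → Fin m) : ℝ :=
  sSup {x | ∃ k : Fin K, ∃ i : Fin m, x = load I τ i k}

/-- Offline optimum makespan over all assignments to `m` machines. -/
noncomputable def OPT (m : ℕ) {K : ℕ} (I : OMSSInstance K) : ℝ :=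
  sInf {x | ∃ τ : ℕ → Fin m, x = mkspan I τ}

/-- Load of machine `i` in scenario `k` among the first `t` jobs. -/
noncomputable def loadUpTo {m K : ℕ} (I : OMSSInstance K) (τ : ℕ → Fin m) (i : Fin m)
    (k : Fin K) (t : ℕ) : ℝ :=
  ∑ j ∈ (I.S k ∩ Finset.Icc 1 t).filter (fun j => τ j = i), I.p j

/-- The makespan contribution of machine `i` among the first `t` jobs (for `OMSS(2,2)`). -/
noncomputable def pMax (I : OMSSInstance 2) (τ : ℕ → Fin 2) (i : Fin 2) (t : ℕ) : ℝ :=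
  max (loadUpTo I τ i 0 t) (loadUpTo I τ i 1 t)

/-- The other one of the two machines. -/
def otherMach : Fin 2 → Fin 2 := fun i => if i = 0 then 1 else 0

/-- Rule 1 for `OMSS(2,2)`: a double-scenario job `j ∈ S_1 ∩ S_2` is assigned to a machine
`i` such that the makespan of the partial schedule on `[j-1]` is attained by the other
machine; if both machines attain it, `j` goes to the machine of job `j-1`
(and job `1` goes to the first machine). -/
def ObeysRule1 (A : OnlineAlg 2 2) : Prop :=
  ∀ I : OMSSInstance 2, ∀ j : ℕ, 1 ≤ j → j ≤ I.n → j ∈ I.S 0 → j ∈ I.S 1 →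
    pMax I (algAssign A I) (otherMach (algAssign A I j)) (j - 1)
        = max (pMax I (algAssign A I) 0 (j - 1)) (pMax I (algAssign A I) 1 (j - 1)) ∧
      (pMax I (algAssign A I) 0 (j - 1) = pMax I (algAssign A I) 1 (j - 1) →
        algAssign A I j = if j = 1 then 0 else algAssign A I (j - 1))

/-- Completion time of job `j`: the maximum over the scenarios containing `j` of the load,
among the first `j` jobs, of `j`'s machine in that scenario. -/
noncomputable def compTime (I : OMSSInstance 2) (τ : ℕ → Fin 2) (j : ℕ) : ℝ :=
  max (if j ∈ I.S 0 then loadUpTo I τ (τ j) 0 j else 0)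
    (if j ∈ I.S 1 then loadUpTo I τ (τ j) 1 j else 0)

/-- The largest completion time of a job of the instance. -/
noncomputable def maxCompTime (I : OMSSInstance 2) (τ : ℕ → Fin 2) : ℝ :=
  sSup {x | ∃ j : ℕ, 1 ≤ j ∧ j ≤ I.n ∧ x = compTime I τ j}

/-- Proxy competitive ratio of a schedule for `OMSS(2,2)`:
the makespan divided by the maximum of the largest average scenario load and the largest
processing time of a job whose completion time attains the overall maximum. -/
noncomputable def proxyRatio (I : OMSSInstance 2) (τ : ℕ → Fin 2) : ℝ :=
  (sSup {x | ∃ i : Fin 2, ∃ k : Fin 2, x = load I τ i k}) /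
    max (max ((∑ j ∈ I.S 0, I.p j) / 2) ((∑ j ∈ I.S 1, I.p j) / 2))
      (sSup {x | ∃ j : ℕ, 1 ≤ j ∧ j ≤ I.n ∧ compTime I τ j = maxCompTime I τ ∧ x = I.p j})

theorem load_le_mkspan {m K : ℕ} (I : OMSSInstance K) (τ : ℕ → Fin m) (i : Fin m) (k : Fin K) :
    load I τ i k ≤ mkspan I τ := by
  refine le_csSup ?_ ⟨k, i, rfl⟩
  refine ((Set.finite_range fun q : Fin K × Fin m => load I τ q.2 q.1).subset ?_).bddAbove
  rintro x ⟨k, i, rfl⟩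
  exact ⟨(k, i), rfl⟩

theorem load_nonneg {m K : ℕ} (I : OMSSInstance K) (τ : ℕ → Fin m) (i : Fin m) (k : Fin K) :
    0 ≤ load I τ i k :=
  Finset.sum_nonneg fun j _ => I.hp j

theorem mkspan_nonneg {m K : ℕ} (I : OMSSInstance K) (τ : ℕ → Fin m) : 0 ≤ mkspan I τ := by
  refine Real.sSup_nonneg ?_
  rintro x ⟨k, i, rfl⟩
  exact load_nonneg I τ i k

theorem mkspan_le {m K : ℕ} (I : OMSSInstance K) (τ : ℕ → Fin m) {c : ℝ} (hc : 0 ≤ c)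
    (h : ∀ k i, load I τ i k ≤ c) : mkspan I τ ≤ c := by
  refine Real.sSup_le ?_ hc
  rintro x ⟨k, i, rfl⟩
  exact h k i

theorem OPT_le_mkspan {m K : ℕ} (I : OMSSInstance K) (τ : ℕ → Fin m) :
    OPT m I ≤ mkspan I τ := by
  refine csInf_le ⟨0, ?_⟩ ⟨τ, rfl⟩
  rintro x ⟨τ, rfl⟩
  exact mkspan_nonneg I τ

/-- Every job that occurs in some scenario is a lower bound for the optimum. -/
theorem processingTime_le_OPT {m K : ℕ} [NeZero m] (I : OMSSInstance K) {k : Fin K} {j : ℕ}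
    (hj : j ∈ I.S k) : I.p j ≤ OPT m I := by
  refine le_csInf ⟨_, fun _ => 0, rfl⟩ ?_
  rintro x ⟨τ, rfl⟩
  refine le_trans ?_ (load_le_mkspan I τ (τ j) k)
  exact Finset.single_le_sum (fun j _ => I.hp j) (Finset.mem_filter.mpr ⟨hj, rfl⟩)

/-- Online assignments of job `j` agree on instances that agree on the first `j` jobs. -/
theorem algAssign_congr {m K : ℕ} (A : OnlineAlg m K) {I I' : OMSSInstance K} {j : ℕ}
    (hp : ∀ j' ≤ j, I.p j' = I'.p j')
    (hS : ∀ k, I.S k ∩ Finset.Icc 1 j = I'.S k ∩ Finset.Icc 1 j) :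
    algAssign A I j = algAssign A I' j := by
  unfold algAssign
  congr 1
  · funext j'
    split_ifs with h
    · exact hp j' h
    · rfl
  · exact funext hS

/-- Processing times of the adversarial jobs. -/
def advTime : ℕ → ℝ
  | 1 => 1
  | 2 => 1
  | 3 => 2
  | 4 => 1
  | 5 => 3
  | _ => 0

theorem advTime_nonneg (j : ℕ) : 0 ≤ advTime j := by
  unfold advTime
  split <;> norm_num

/-- Two unit jobs of the first scenario. -/
def shortAdversary : OMSSInstance 2 where
  n := 2
  p := advTime
  hp := advTime_nonneg
  S := ![{1, 2}, ∅]
  hS := by decide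

/-- The jobs of `shortAdversary`, then a job of length `2` in the second scenario and
double-scenario jobs of lengths `1` and `3`. -/
def longAdversary : OMSSInstance 2 where
  n := 5
  p := advTime
  hp := advTime_nonneg
  S := ![{1, 2, 4, 5}, {3, 4, 5}]
  hS := by decide

theorem shortAdversary_OPT_le : OPT 2 shortAdversary ≤ 1 := by
  refine (OPT_le_mkspan _ fun j => if j = 1 then 0 else 1).trans (mkspan_le _ _ (by norm_num) ?_)
  intro k i
  fin_cases k <;> fin_cases i <;>
    simp [load, shortAdversary, Finset.sum_filter, advTime]

theorem longAdversary_OPT_le : OPT 2 longAdversary ≤ 3 := by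
  refine (OPT_le_mkspan _ fun j => if j = 5 then 0 else 1).trans (mkspan_le _ _ (by norm_num) ?_)
  intro k i
  fin_cases k <;> fin_cases i <;>
    norm_num [load, longAdversary, Finset.sum_filter, advTime]

theorem two_le_mkspan_shortAdversary {τ : ℕ → Fin 2} (h : τ 1 = τ 2) :
    2 ≤ mkspan shortAdversary τ := by
  refine le_trans ?_ (load_le_mkspan shortAdversary τ (τ 2) 0)
  norm_num [load, shortAdversary, Finset.sum_filter, advTime, h]

theorem loadUpTo_longAdversary_three (τ : ℕ → Fin 2) (i : Fin 2) :
    loadUpTo longAdversary τ i 0 3 = (if τ 1 = i then 1 else 0) + (if τ 2 = i then 1 else 0) ∧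
    loadUpTo longAdversary τ i 1 3 = if τ 3 = i then 2 else 0 := by
  have h0 : longAdversary.S 0 ∩ Finset.Icc 1 3 = {1, 2} := by decide
  have h1 : longAdversary.S 1 ∩ Finset.Icc 1 3 = {3} := by decide
  constructor <;> simp [loadUpTo, h0, h1, Finset.sum_filter] <;> simp [longAdversary, advTime]

theorem loadUpTo_longAdversary_four (τ : ℕ → Fin 2) (i : Fin 2) :
    loadUpTo longAdversary τ i 0 4 =
      (if τ 1 = i then 1 else 0) + ((if τ 2 = i then 1 else 0) + if τ 4 = i then 1 else 0) ∧
    loadUpTo longAdversary τ i 1 4 = (if τ 3 = i then 2 else 0) + if τ 4 = i then 1 else 0 := by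
  have h0 : longAdversary.S 0 ∩ Finset.Icc 1 4 = {1, 2, 4} := by decide
  have h1 : longAdversary.S 1 ∩ Finset.Icc 1 4 = {3, 4} := by decide
  constructor <;> simp [loadUpTo, h0, h1, Finset.sum_filter] <;> simp [longAdversary, advTime]

/-- If the first two jobs are separated, Rule 1 puts job `4` opposite to job `3`, and then,
by the tie-breaking clause, job `5` on the machine of job `4`. -/
theorem assign_longAdversary {A : OnlineAlg 2 2} (hA : ObeysRule1 A)
    (h : algAssign A longAdversary 1 ≠ algAssign A longAdversary 2) :
    algAssign A longAdversary 5 = algAssign A longAdversary 4 := by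
  have h4 := (hA longAdversary 4 (by decide) (by decide) (by decide) (by decide)).1
  have h5 := (hA longAdversary 5 (by decide) (by decide) (by decide) (by decide)).2
  simp only [pMax, Nat.reduceSub, loadUpTo_longAdversary_three, loadUpTo_longAdversary_four]
    at h4 h5
  generalize algAssign A longAdversary 1 = a at *
  generalize algAssign A longAdversary 2 = b at *
  generalize algAssign A longAdversary 3 = c at *
  generalize algAssign A longAdversary 4 = d at *
  generalize algAssign A longAdversary 5 = e at *
  fin_cases a <;> fin_cases b <;> fin_cases c <;> fin_cases d <;>
    first
    | exact absurd rfl h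
    | (norm_num [otherMach] at h4; done)
    | (norm_num at h5; exact h5)

theorem five_le_mkspan_longAdversary {τ : ℕ → Fin 2} (h : τ 1 ≠ τ 2) (h5 : τ 5 = τ 4) :
    5 ≤ mkspan longAdversary τ := by
  refine le_trans ?_ (load_le_mkspan longAdversary τ (τ 4) 0)
  generalize hd : τ 4 = d at *
  generalize ha : τ 1 = a at *
  generalize hb : τ 2 = b at *
  fin_cases a <;> fin_cases b <;> fin_cases d <;>
    first
    | exact absurd rfl h
    | norm_num [load, longAdversary, Finset.sum_filter, advTime, ha, hb, hd, h5]

theorem exists_OPT_pos_and_five_thirds_mul_OPT_le {A : OnlineAlg 2 2} (hA : ObeysRule1 A) :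
    ∃ I : OMSSInstance 2, 0 < OPT 2 I ∧ (5 / 3 : ℝ) * OPT 2 I ≤ mkspan I (algAssign A I) := by
  by_cases h : algAssign A longAdversary 1 = algAssign A longAdversary 2
  · have e1 : algAssign A shortAdversary 1 = algAssign A longAdversary 1 :=
      algAssign_congr A (fun _ _ => rfl) (by decide)
    have e2 : algAssign A shortAdversary 2 = algAssign A longAdversary 2 :=
      algAssign_congr A (fun _ _ => rfl) (by decide)
    refine ⟨shortAdversary, ?_, ?_⟩
    · exact one_pos.trans_le
        (processingTime_le_OPT (k := 0) (j := 1) shortAdversary (by decide))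
    · have := two_le_mkspan_shortAdversary (e1.trans (h.trans e2.symm))
      linarith [shortAdversary_OPT_le]
  · refine ⟨longAdversary, ?_, ?_⟩
    · exact one_pos.trans_le
        (processingTime_le_OPT (k := 0) (j := 1) longAdversary (by decide))
    · have := five_le_mkspan_longAdversary h (assign_longAdversary hA h)
      linarith [longAdversary_OPT_le]

/-- **Observation.** Every deterministic online algorithm for `OMSS(2,2)` obeying Rule 1
admits an instance on which its makespan is at least `5/3` times the optimum; hence no
deterministic online algorithm obeying Rule 1 is `r`-competitive for any `r < 5/3`. -/
theorem rule1_no_better_than_five_thirds :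
    (∀ A : OnlineAlg 2 2, ObeysRule1 A → ∃ I : OMSSInstance 2,
        (5 / 3 : ℝ) * OPT 2 I ≤ mkspan I (algAssign A I)) ∧
      ∀ r : ℝ, r < 5 / 3 →
        ¬ ∃ A : OnlineAlg 2 2, ObeysRule1 A ∧ ∀ I : OMSSInstance 2,
            mkspan I (algAssign A I) ≤ r * OPT 2 I := by
  refine ⟨fun A hA => ?_, ?_⟩
  · obtain ⟨I, -, hI⟩ := exists_OPT_pos_and_five_thirds_mul_OPT_le hA
    exact ⟨I, hI⟩
  · rintro r hr ⟨A, hA, hcomp⟩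
    obtain ⟨I, hpos, hI⟩ := exists_OPT_pos_and_five_thirds_mul_OPT_le hA
    exact absurd (hI.trans (hcomp I)) (not_le.mpr (mul_lt_mul_of_pos_right hr hpos))
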